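/- Let X be a complete metric space satisfying the NPC inequality, let p ∈ X, and let S ⊆ X be a closed set having the geodesic extension property relative to p. Then for all 0 < r ≤ R, monotonicity of density holds: μH²(S ∩ B̄(p,r))/r² ≤ μH²(S ∩ B̄(p,R))/R², where B̄(p,r) denotes the closed ball of radius r about p. -/

import Mathlib

open MeasureTheory

/-- A metric space satisfies the NPC inequality if every pair of points has a
midpoint satisfying the CAT(0) comparison inequality. -/
def NPC (X : Type*) [MetricSpace X] : Prop :=
  ∀ x y : X, ∃ m : X, dist x m = dist x y / 2 ∧ dist y m = dist x y / 2 ∧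
    ∀ z : X, dist z m ^ 2 ≤
      (1 / 2) * dist z x ^ 2 + (1 / 2) * dist z y ^ 2 - (1 / 4) * dist x y ^ 2

/-- A subset `S` of a metric space has the geodesic extension property relative to a
basepoint `p` if every `x ∈ S` lies on a unit-speed geodesic ray issuing from `p`
which stays in `S` after it passes through `x`. -/
def GeodesicExtensionProperty {X : Type*} [MetricSpace X] (p : X) (S : Set X) : Prop :=
  ∀ x ∈ S, ∃ η : ℝ → X,
    (∀ s t : ℝ, 0 ≤ s → 0 ≤ t → dist (η s) (η t) = |s - t|) ∧
    η 0 = p ∧ η (dist p x) = x ∧ ∀ t : ℝ, dist p x ≤ t → η t ∈ S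

/-- Points halfway between `x` and `y` satisfy the NPC inequality. -/
theorem NPC.dist_sq_le {X : Type*} [MetricSpace X] (hX : NPC X) {x y m : X}
    (hx : dist x m = dist x y / 2) (hy : dist y m = dist x y / 2) (z : X) :
    dist z m ^ 2 ≤
      (1 / 2) * dist z x ^ 2 + (1 / 2) * dist z y ^ 2 - (1 / 4) * dist x y ^ 2 := by
  obtain ⟨n, -, -, hn⟩ := hX x y
  have h := hn m
  rw [dist_comm m x, dist_comm m y, hx, hy] at h
  have hmn : dist m n = 0 := by
    have : dist m n ^ 2 ≤ 0 := by linarith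
    exact pow_eq_zero_iff two_ne_zero |>.1 (le_antisymm this (sq_nonneg _))
  rw [dist_eq_zero.1 hmn]
  exact hn z

/-- In an NPC space, the midline of a triangle is at most half as long as its base. -/
theorem NPC.dist_midpoints_triangle_le {X : Type*} [MetricSpace X] (hX : NPC X)
    {p x y m n : X}
    (hpm : dist p m = dist p x / 2) (hxm : dist x m = dist p x / 2)
    (hpn : dist p n = dist p y / 2) (hyn : dist y n = dist p y / 2) :
    dist m n ≤ dist x y / 2 := by
  have h₁ := hX.dist_sq_le hpn hyn m
  have h₂ := hX.dist_sq_le hpm hxm y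
  rw [dist_comm m p, hpm, dist_comm m y] at h₁
  rw [dist_comm y p, dist_comm y x] at h₂
  refine le_of_sq_le_sq ?_ (by positivity)
  nlinarith

/-- In an NPC space, the distance between the midpoints of two segments is at most the
mean of the distances between their endpoints. -/
theorem NPC.dist_midpoints_le {X : Type*} [MetricSpace X] (hX : NPC X)
    {x x' y y' m n : X}
    (hxm : dist x m = dist x x' / 2) (hxm' : dist x' m = dist x x' / 2)
    (hyn : dist y n = dist y y' / 2) (hyn' : dist y' n = dist y y' / 2) :
    dist m n ≤ (dist x y + dist x' y') / 2 := by
  obtain ⟨q, hq, hq', -⟩ := hX x y'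
  have h₁ := hX.dist_midpoints_triangle_le hxm hxm' hq hq'
  have h₂ : dist q n ≤ dist x y / 2 :=
    hX.dist_midpoints_triangle_le (p := y') (by rw [hq', dist_comm x])
      (by rw [hq, dist_comm x]) (by rw [hyn', dist_comm y]) (by rw [hyn, dist_comm y])
  linarith [dist_triangle m q n]

/-- A continuous midpoint-convex function on `[0, 1]` that vanishes at `0` lies below the
chord joining its endpoints. -/
theorem le_mul_of_midpoint_convex {h : ℝ → ℝ} (hc : ContinuousOn h (Set.Icc 0 1))
    (h0 : h 0 = 0)
    (hmid : ∀ s ∈ Set.Icc (0 : ℝ) 1, ∀ t ∈ Set.Icc (0 : ℝ) 1,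
      h ((s + t) / 2) ≤ (h s + h t) / 2)
    {t : ℝ} (ht : t ∈ Set.Icc (0 : ℝ) 1) : h t ≤ t * h 1 := by
  set g : ℝ → ℝ := fun t => h t - t * h 1 with hg
  have hgc : ContinuousOn g (Set.Icc 0 1) := by fun_prop
  obtain ⟨u, hu, hmax⟩ := isCompact_Icc.exists_isMaxOn ⟨t, ht⟩ hgc
  have hK : IsCompact (Set.Icc (0 : ℝ) 1 ∩ g ⁻¹' {g u}) :=
    isCompact_Icc.of_isClosed_subset
      (hgc.preimage_isClosed_of_isClosed isClosed_Icc isClosed_singleton)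
      Set.inter_subset_left
  obtain ⟨v, ⟨hv, hvu⟩, hmin⟩ := hK.exists_isLeast ⟨u, hu, rfl⟩
  replace hvu : g v = g u := hvu
  have key : g t ≤ g v := hvu ▸ hmax ht
  suffices g v ≤ 0 by
    have : h t - t * h 1 ≤ 0 := key.trans this
    linarith
  rcases hv.1.eq_or_lt with hv0 | hv0
  · simp [hg, ← hv0, h0]
  rcases hv.2.eq_or_lt with hv1 | hv1
  · simp [hg, hv1]
  exfalso
  set d := min v (1 - v) with hd
  have hdpos : 0 < d := lt_min hv0 (by linarith)
  have hdv : d ≤ v := min_le_left _ _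
  have hdv' : d ≤ 1 - v := min_le_right _ _
  have hl : v - d ∈ Set.Icc (0 : ℝ) 1 := ⟨by linarith, by linarith⟩
  have hr : v + d ∈ Set.Icc (0 : ℝ) 1 := ⟨by linarith, by linarith⟩
  have hgl : g (v - d) < g u := by
    refine lt_of_le_of_ne (hmax hl) fun heq => ?_
    have := hmin ⟨hl, heq⟩
    linarith
  have hgr : g (v + d) ≤ g u := hmax hr
  have hm := hmid _ hl _ hr
  rw [show (v - d + (v + d)) / 2 = v by ring] at hm
  simp only [hg] at hgl hgr hvu
  linarith

/-- In an NPC space, moving two points towards a common basepoint along geodesics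
contracts distances by the corresponding factor. -/
theorem NPC.dist_geodesic_contract_le {X : Type*} [MetricSpace X] (hX : NPC X)
    {η θ : ℝ → X}
    (hη : ∀ s t : ℝ, 0 ≤ s → 0 ≤ t → dist (η s) (η t) = |s - t|)
    (hθ : ∀ s t : ℝ, 0 ≤ s → 0 ≤ t → dist (θ s) (θ t) = |s - t|)
    (h0 : η 0 = θ 0) {a b c : ℝ} (ha : 0 ≤ a) (hb : 0 ≤ b)
    (hc : c ∈ Set.Icc (0 : ℝ) 1) :
    dist (η (c * a)) (θ (c * b)) ≤ c * dist (η a) (θ b) := by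
  have hcont : ∀ {γ : ℝ → X} {e : ℝ}, 0 ≤ e →
      (∀ s t : ℝ, 0 ≤ s → 0 ≤ t → dist (γ s) (γ t) = |s - t|) →
      ContinuousOn (fun t => γ (t * e)) (Set.Icc 0 1) := by
    intro γ e he hγ
    have : ContinuousOn γ (Set.Ici 0) :=
      (LipschitzOnWith.of_dist_le_mul (K := 1) fun s hs t ht => by
        simp [hγ s t hs ht, Real.dist_eq]).continuousOn
    exact this.comp (by fun_prop) fun t ht => mul_nonneg ht.1 he
  have hhalf : ∀ {γ : ℝ → X}, (∀ s t : ℝ, 0 ≤ s → 0 ≤ t → dist (γ s) (γ t) = |s - t|) →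
      ∀ {s t : ℝ}, 0 ≤ s → 0 ≤ t →
        dist (γ s) (γ ((s + t) / 2)) = dist (γ s) (γ t) / 2 ∧
        dist (γ t) (γ ((s + t) / 2)) = dist (γ s) (γ t) / 2 := by
    intro γ hγ s t hs ht
    rw [hγ _ _ hs (by positivity), hγ _ _ ht (by positivity), hγ _ _ hs ht,
      show s - (s + t) / 2 = (s - t) / 2 by ring,
      show t - (s + t) / 2 = -((s - t) / 2) by ring, abs_neg, abs_div, abs_two]
    exact ⟨rfl, rfl⟩
  have := le_mul_of_midpoint_convex (h := fun t => dist (η (t * a)) (θ (t * b)))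
    (continuous_dist.comp_continuousOn ((hcont ha hη).prodMk (hcont hb hθ)))
    (by simp [h0]) (fun s hs t ht => by
      have h₁ := hhalf hη (mul_nonneg hs.1 ha) (mul_nonneg ht.1 ha)
      have h₂ := hhalf hθ (mul_nonneg hs.1 hb) (mul_nonneg ht.1 hb)
      have := hX.dist_midpoints_le h₁.1 h₁.2 h₂.1 h₂.2
      rwa [show (s * a + t * a) / 2 = (s + t) / 2 * a by ring,
        show (s * b + t * b) / 2 = (s + t) / 2 * b by ring] at this) hc
  simpa using this

/-- Monotonicity of density: for a closed set `S` with the geodesic extension property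
relative to `p` in a complete NPC space, the ratio `μH²(S ∩ B̄(p,r)) / r²` is
nondecreasing in `r`. -/
theorem density_monotone
    (X : Type*) [MetricSpace X] [CompleteSpace X]
    [MeasurableSpace X] [BorelSpace X] (hX : NPC X)
    (p : X) (S : Set X) (hclosed : IsClosed S)
    (hS : GeodesicExtensionProperty p S)
    (r R : ℝ) (hr : 0 < r) (hrR : r ≤ R) :
    μH[2] (S ∩ Metric.closedBall p r) / ENNReal.ofReal (r ^ 2) ≤
      μH[2] (S ∩ Metric.closedBall p R) / ENNReal.ofReal (R ^ 2) := by
  have hR : 0 < R := hr.trans_le hrR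
  choose! η hη hη0 hηx hηS using hS
  set g : (S ∩ Metric.closedBall p r : Set X) → X :=
    fun x => η x (R / r * dist p x) with hg
  have hone : 1 ≤ R / r := (one_le_div hr).2 hrR
  have hanti : AntilipschitzWith (r / R).toNNReal g := by
    refine AntilipschitzWith.of_le_mul_dist fun x y => ?_
    have h := hX.dist_geodesic_contract_le (hη x x.2.1) (hη y y.2.1)
      ((hη0 x x.2.1).trans (hη0 y y.2.1).symm)
      (a := R / r * dist p x) (b := R / r * dist p y) (c := r / R)
      (by positivity) (by positivity) ⟨by positivity, (div_le_one hR).2 hrR⟩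
    have hcancel : ∀ e : ℝ, r / R * (R / r * e) = e := fun e => by field_simp
    rw [hcancel, hcancel, hηx x x.2.1, hηx y y.2.1] at h
    rwa [Real.coe_toNNReal _ (by positivity)]
  have himage : g '' Set.univ ⊆ S ∩ Metric.closedBall p R := by
    rintro _ ⟨x, -, rfl⟩
    refine ⟨hηS x x.2.1 _ (le_mul_of_one_le_left dist_nonneg hone), ?_⟩
    have hxr : dist p x ≤ r := by
      rw [dist_comm]
      exact x.2.2
    have h := hη x x.2.1 (R / r * dist p x) 0 (by positivity) le_rfl
    rw [hη0 x x.2.1, sub_zero, abs_of_nonneg (by positivity)] at h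
    rw [Metric.mem_closedBall, h]
    calc R / r * dist p x ≤ R / r * r := by gcongr
      _ = R := by field_simp
  have hmeas : μH[2] (S ∩ Metric.closedBall p r) ≤
      ENNReal.ofReal (r / R) ^ (2 : ℝ) * μH[2] (S ∩ Metric.closedBall p R) := by
    have h := hanti.le_hausdorffMeasure_image zero_le_two Set.univ
    rw [← isometry_subtype_coe.hausdorffMeasure_image (Or.inl zero_le_two), Set.image_univ,
      Subtype.range_coe] at h
    exact h.trans (mul_le_mul_right (measure_mono himage) _)
  have hscale : ENNReal.ofReal (r / R) ^ (2 : ℝ) =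
      ENNReal.ofReal (r ^ 2) / ENNReal.ofReal (R ^ 2) := by
    rw [ENNReal.rpow_two, ← ENNReal.ofReal_pow (by positivity), div_pow,
      ENNReal.ofReal_div_of_pos (by positivity)]
  rw [hscale] at hmeas
  refine ENNReal.div_le_of_le_mul (hmeas.trans_eq ?_)
  simp only [div_eq_mul_inv]
  ring
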